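/- With a supermetric and super-oscillator algebra as in the context, set ω := Σ_{a,b} ε̄^{ab}ε_{ab} and β := 1 − ω/2, and for v ∈ ℂ define in A the elements Λ^a_c(v) := (v+β)·δ^a_c·1 + ε(−1)^{[c]} c^a c_c and Λ̃^c_b(v) := v·δ^c_b·1 − ε(−1)^{[b]} c^c c_b, and the complex numbers R^{ac}_{bp}(v) := v(v+β)·δ^a_b δ^c_p − ε(v+β)·(−1)^{[a][c]} δ^a_p δ^c_b + v·ε̄^{ac} ε_{bp}. Then the intertwining identity holds: for all v ∈ ℂ and all a, b, p ∈ I, Σ_c (−1)^{[p]([b]+[c])} · Λ^a_c(v) · c_p · Λ̃^c_b(v) = Σ_c (−1)^{[a][p]+[b][c]} · R^{ac}_{bp}(v) · c_c. -/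

import Mathlib

/-- The sign (−1)^x for a parity x ∈ ZMod 2. -/
noncomputable def sg (x : ZMod 2) : ℂ := if x = 0 then 1 else -1

theorem sg_add (x y : ZMod 2) : sg (x + y) = sg x * sg y := by
  have h : ∀ z : ZMod 2, z = 0 ∨ z = 1 := by decide
  rcases h x with rfl | rfl <;> rcases h y with rfl | rfl <;>
    simp [sg, CharTwo.add_self_eq_zero]

theorem sg_mul_self (x : ZMod 2) : sg x * sg x = 1 := by
  unfold sg; split_ifs <;> norm_num

theorem sg_apply_mul_self (x : ZMod 2) : sg (x * x) = sg x := by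
  fin_cases x <;> rfl

theorem parity_eq_of_add_eq_zero {x y : ZMod 2} (h : x + y = 0) : x = y := by
  rw [← sub_eq_zero, CharTwo.sub_eq_add, h]

/-- Lowering the index of a family by a bilinear form: `c_a = Σ_b ε_{ab} c^b`. -/
def lowered {n : ℕ} {A : Type*} [Ring A] [Algebra ℂ A] (εlo : Matrix (Fin n) (Fin n) ℂ)
    (c : Fin n → A) (a : Fin n) : A := ∑ b, εlo a b • c b

section SuperOscillator

variable {n : ℕ} {p : Fin n → ZMod 2} {ε : ℂ} {εlo εhi : Matrix (Fin n) (Fin n) ℂ}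
  {A : Type*} [Ring A] [Algebra ℂ A] {c : Fin n → A}

theorem lowered_mul
    (hlo0 : ∀ a b, p a + p b ≠ 0 → εlo a b = 0)
    (hinv2 : ∀ a c, (∑ b, εlo a b * εhi b c) = if a = c then 1 else 0)
    (hosc : ∀ a b, c a * c b + (ε * sg (p a * p b)) • (c b * c a) = εhi a b • (1 : A))
    (a b : Fin n) :
    lowered εlo c a * c b =
      (if a = b then 1 else 0 : ℂ) • (1 : A) - (ε * sg (p a * p b)) • (c b * lowered εlo c a) := by
  rw [← hinv2 a b, lowered, Finset.sum_mul, Finset.mul_sum, Finset.smul_sum, Finset.sum_smul,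
    ← Finset.sum_sub_distrib]
  refine Finset.sum_congr rfl fun d _ => ?_
  by_cases h : p a + p d = 0
  · rw [parity_eq_of_add_eq_zero h, mul_smul (εlo a d), ← hosc d b, smul_mul_assoc,
      mul_smul_comm]
    module
  · simp [hlo0 a d h]

theorem lowered_mul_lowered
    (hlo0 : ∀ a b, p a + p b ≠ 0 → εlo a b = 0)
    (hinv2 : ∀ a c, (∑ b, εlo a b * εhi b c) = if a = c then 1 else 0)
    (hosc : ∀ a b, c a * c b + (ε * sg (p a * p b)) • (c b * c a) = εhi a b • (1 : A))
    (a b : Fin n) :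
    lowered εlo c a * lowered εlo c b =
      εlo b a • (1 : A) - (ε * sg (p a * p b)) • (lowered εlo c b * lowered εlo c a) := by
  have key (d : Fin n) : lowered εlo c a * (εlo b d • c d) =
      (εlo b d * if a = d then 1 else 0 : ℂ) • (1 : A) -
        (ε * sg (p a * p b)) • (εlo b d • c d * lowered εlo c a) := by
    by_cases h : p b + p d = 0
    · rw [mul_smul_comm, lowered_mul hlo0 hinv2 hosc, parity_eq_of_add_eq_zero h, smul_mul_assoc]
      module
    · simp [hlo0 b d h]
  conv_lhs => rw [lowered.eq_1 εlo c b, Finset.mul_sum]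
  rw [Finset.sum_congr rfl fun d _ => key d, Finset.sum_sub_distrib, ← Finset.sum_smul,
    ← Finset.smul_sum, ← Finset.sum_mul, ← lowered]
  simp

theorem sum_smul_lowered
    (hinv1 : ∀ a c, (∑ b, εhi a b * εlo b c) = if a = c then 1 else 0) (a : Fin n) :
    ∑ b, εhi a b • lowered εlo c b = c a := by
  simp_rw [lowered, Finset.smul_sum, smul_smul]
  rw [Finset.sum_comm]
  simp_rw [← Finset.sum_smul, hinv1]
  simp

theorem sum_lowered_mul (hε : ε = 1 ∨ ε = -1)
    (hlo0 : ∀ a b, p a + p b ≠ 0 → εlo a b = 0)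
    (hlosym : ∀ a b, εlo a b = ε * sg (p a * p b) * εlo b a)
    (hosc : ∀ a b, c a * c b + (ε * sg (p a * p b)) • (c b * c a) = εhi a b • (1 : A)) :
    ∑ a, sg (p a) • (lowered εlo c a * c a) =
      (ε * ((∑ a, ∑ b, εhi a b * εlo a b) / 2)) • (1 : A) := by
  have hεε : ε * ε = 1 := by rcases hε with rfl | rfl <;> norm_num
  have expand : ∑ a, sg (p a) • (lowered εlo c a * c a) =
      ∑ a, ∑ b, (sg (p a) * εlo a b) • (c b * c a) := by
    simp_rw [lowered, Finset.sum_mul, Finset.smul_sum, smul_mul_assoc, smul_smul]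
  have swap : ∑ a, ∑ b, (sg (p a) * εlo a b) • (c b * c a) =
      ∑ a, ∑ b, (ε * εlo a b) • (c a * c b) := by
    rw [Finset.sum_comm]
    refine Finset.sum_congr rfl fun a _ => Finset.sum_congr rfl fun b _ => ?_
    by_cases h : p a + p b = 0
    · rw [hlosym b a, parity_eq_of_add_eq_zero h, sg_apply_mul_self]
      congr 1
      linear_combination ε * εlo a b * sg_mul_self (p b)
    · rw [hlosym b a, hlo0 a b h]; simp
  have double : ∑ a, ∑ b, (sg (p a) * εlo a b) • (c b * c a) +
      ∑ a, ∑ b, (ε * εlo a b) • (c a * c b) =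
      (ε * ∑ a, ∑ b, εhi a b * εlo a b) • (1 : A) := by
    simp_rw [Finset.mul_sum, Finset.sum_smul, ← Finset.sum_add_distrib]
    refine Finset.sum_congr rfl fun a _ => Finset.sum_congr rfl fun b _ => ?_
    by_cases h : p a + p b = 0
    · rw [show ε * (εhi a b * εlo a b) = ε * εlo a b * εhi a b by ring, mul_smul _ (εhi a b),
        ← hosc a b, ← parity_eq_of_add_eq_zero h, sg_apply_mul_self, smul_add, smul_smul, add_comm]
      congr 2
      linear_combination -(sg (p a) * εlo a b) * hεε
    · simp [hlo0 a b h]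
  rw [← swap, ← two_smul ℂ, ← expand] at double
  rw [← one_smul ℂ (∑ a, _), show (1 : ℂ) = 2⁻¹ * 2 by norm_num, mul_smul, double, smul_smul]
  congr 1
  ring

theorem sum_lowered_mul_lowered_mul (hε : ε = 1 ∨ ε = -1)
    (hlo0 : ∀ a b, p a + p b ≠ 0 → εlo a b = 0)
    (hlosym : ∀ a b, εlo a b = ε * sg (p a * p b) * εlo b a)
    (hinv2 : ∀ a c, (∑ b, εlo a b * εhi b c) = if a = c then 1 else 0)
    (hosc : ∀ a b, c a * c b + (ε * sg (p a * p b)) • (c b * c a) = εhi a b • (1 : A))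
    (q : Fin n) :
    ∑ a, (sg (p q * p a) * sg (p a)) • (lowered εlo c a * lowered εlo c q * c a) =
      (1 - (∑ a, ∑ b, εhi a b * εlo a b) / 2) • lowered εlo c q := by
  have hεε : ε * ε = 1 := by rcases hε with rfl | rfl <;> norm_num
  have key (a : Fin n) :
      (sg (p q * p a) * sg (p a)) • (lowered εlo c a * lowered εlo c q * c a) =
        (if q = a then lowered εlo c a else 0) -
          ε • (sg (p a) • (lowered εlo c a * c a) * lowered εlo c q) := by
    rw [mul_assoc, lowered_mul hlo0 hinv2 hosc, mul_sub, mul_smul_comm, mul_smul_comm, mul_one,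
      smul_sub, smul_smul, smul_smul, smul_mul_assoc, smul_smul, mul_assoc (lowered εlo c a)]
    congr 1
    · split_ifs with h
      · rw [h, sg_apply_mul_self, mul_one, sg_mul_self, one_smul]
      · simp
    · congr 1
      linear_combination ε * sg (p a) * sg_mul_self (p q * p a)
  rw [Finset.sum_congr rfl fun a _ => key a, Finset.sum_sub_distrib, ← Finset.smul_sum,
    ← Finset.sum_mul, sum_lowered_mul hε hlo0 hlosym hosc, Finset.sum_ite_eq, smul_mul_assoc,
    one_mul, smul_smul, ← mul_assoc, hεε]
  simp [sub_smul]

end SuperOscillator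

/-- The intertwining identity expressing the fusion of two super-oscillator L-operators
into the fundamental osp R-matrix: Σ_c (−1)^{[p]([b]+[c])} Λ^a_c(v) c_p Λ̃^c_b(v)
= Σ_c (−1)^{[a][p]+[b][c]} R^{ac}_{bp}(v) c_c. -/
theorem fusion_intertwining_identity
    (n : ℕ) (p : Fin n → ZMod 2) (ε : ℂ) (hε : ε = 1 ∨ ε = -1)
    (εlo εhi : Matrix (Fin n) (Fin n) ℂ)
    (hlo0 : ∀ a b, p a + p b ≠ 0 → εlo a b = 0)
    (hhi0 : ∀ a b, p a + p b ≠ 0 → εhi a b = 0)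
    (hlosym : ∀ a b, εlo a b = ε * sg (p a * p b) * εlo b a)
    (hhisym : ∀ a b, εhi a b = ε * sg (p a * p b) * εhi b a)
    (hinv1 : ∀ a c, (∑ b, εhi a b * εlo b c) = if a = c then 1 else 0)
    (hinv2 : ∀ a c, (∑ b, εlo a b * εhi b c) = if a = c then 1 else 0)
    (A : Type*) [Ring A] [Algebra ℂ A] (c : Fin n → A)
    (hosc : ∀ a b, c a * c b + (ε * sg (p a * p b)) • (c b * c a) = εhi a b • (1 : A)) :
    let ω : ℂ := ∑ a, ∑ b, εhi a b * εlo a b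
    let β : ℂ := 1 - ω / 2
    let clo : Fin n → A := fun a => ∑ b, εlo a b • c b
    let Lam : ℂ → Fin n → Fin n → A := fun v a cc =>
      ((v + β) * (if a = cc then 1 else 0)) • (1 : A) + (ε * sg (p cc)) • (c a * clo cc)
    let Lamt : ℂ → Fin n → Fin n → A := fun v cc b =>
      (v * (if cc = b then 1 else 0)) • (1 : A) - (ε * sg (p b)) • (c cc * clo b)
    let R : ℂ → Fin n → Fin n → Fin n → Fin n → ℂ := fun v a cc b q =>
      v * (v + β) * (if a = b then 1 else 0) * (if cc = q then 1 else 0) -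
        ε * (v + β) * sg (p a * p cc) * (if a = q then 1 else 0) * (if cc = b then 1 else 0) +
        v * εhi a cc * εlo b q
    ∀ (v : ℂ) (a b q : Fin n),
      (∑ cc, sg (p q * (p b + p cc)) • (Lam v a cc * clo q * Lamt v cc b)) =
        ∑ cc, (sg (p a * p q + p b * p cc) * R v a cc b q) • clo cc := by
  intro ω β clo Lam Lamt R v a b q
  have hεε : ε * ε = 1 := by rcases hε with rfl | rfl <;> norm_num
  have hmid : ∑ d, (sg (p q * p d) * sg (p d)) • (clo d * clo q * c d) = β • clo q :=
    sum_lowered_mul_lowered_mul hε hlo0 hlosym hinv2 hosc q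
  have hraise : ∑ d, εhi a d • clo d = c a := sum_smul_lowered hinv1 a
  have hmul : clo q * c a = (if q = a then 1 else 0 : ℂ) • (1 : A) -
      (ε * sg (p q * p a)) • (c a * clo q) := lowered_mul hlo0 hinv2 hosc q a
  have hlow : clo b * clo q = εlo q b • (1 : A) - (ε * sg (p b * p q)) • (clo q * clo b) :=
    lowered_mul_lowered hlo0 hinv2 hosc b q
  have hL (d : Fin n) : sg (p q * (p b + p d)) • (Lam v a d * clo q * Lamt v d b) =
      (if a = d then (sg (p q * p b) * sg (p q * p d) * (v + β)) •
        (clo q * ((v * (if d = b then 1 else 0)) • (1 : A) - (ε * sg (p b)) • (c d * clo b)))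
        else 0) +
      (if d = b then (sg (p q * p b) * sg (p q * p d) * v * ε * sg (p d)) •
        (c a * (clo d * clo q)) else 0) -
      (ε * ε * sg (p q * p b) * sg (p b)) •
        (c a * ((sg (p q * p d) * sg (p d)) • (clo d * clo q * c d)) * clo b) := by
    simp only [Lam, Lamt, mul_add, sg_add]
    split_ifs <;>
      simp only [add_mul, mul_sub, smul_mul_assoc, mul_smul_comm, one_mul, mul_one, mul_assoc] <;>
      module
  have hR (d : Fin n) : (sg (p a * p q + p b * p d) * R v a d b q) • clo d =
      (if d = q then (v * (v + β) * (if a = b then 1 else 0)) • clo d else 0) -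
      (if d = b then (ε * (v + β) * sg (p a * p q) * sg (p b) * sg (p a * p b) *
        (if a = q then 1 else 0)) • clo d else 0) +
      (v * εlo b q) • (εhi a d • clo d) := by
    have h₁ : sg (p a * p q) * sg (p b * p d) * (if a = b then 1 else 0) *
        (if d = q then 1 else 0) = (if a = b then 1 else 0) * (if d = q then 1 else 0) := by
      split_ifs with hab hdq
      · rw [hab, hdq, sg_mul_self]; ring
      all_goals simp
    have h₂ : sg (p b * p d) * sg (p a * p d) * (if d = b then 1 else 0) =
        sg (p b) * sg (p a * p b) * (if d = b then 1 else 0) := by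
      split_ifs with hdb
      · rw [hdb, sg_apply_mul_self]
      · simp
    have h₃ : sg (p a * p q) * sg (p b * p d) * εhi a d * εlo b q = εhi a d * εlo b q := by
      by_cases had : p a + p d = 0
      · by_cases hbq : p b + p q = 0
        · rw [parity_eq_of_add_eq_zero had, parity_eq_of_add_eq_zero hbq, mul_comm (p q),
            sg_mul_self, one_mul]
        · simp [hlo0 b q hbq]
      · simp [hhi0 a d had]
    have coeff : sg (p a * p q + p b * p d) * R v a d b q =
        v * (v + β) * (if a = b then 1 else 0) * (if d = q then 1 else 0) -
        ε * (v + β) * sg (p a * p q) * sg (p b) * sg (p a * p b) *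
          (if a = q then 1 else 0) * (if d = b then 1 else 0) + v * εlo b q * εhi a d := by
      simp only [R, sg_add]
      linear_combination v * (v + β) * h₁ -
        ε * (v + β) * sg (p a * p q) * (if a = q then 1 else 0) * h₂ + v * h₃
    rw [coeff]
    split_ifs <;> module
  have hsym : ε * sg (p b) * εlo q b = εlo b q := by
    by_cases h : p b + p q = 0
    · rw [hlosym b q, ← parity_eq_of_add_eq_zero h, sg_apply_mul_self]
    · rw [hlosym q b, hlo0 b q h]; simp
  rw [Finset.sum_congr rfl fun d _ => hL d, Finset.sum_congr rfl fun d _ => hR d]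
  simp only [Finset.sum_add_distrib, Finset.sum_sub_distrib, Finset.sum_ite_eq,
    Finset.sum_ite_eq', Finset.mem_univ, if_true, ← Finset.smul_sum, ← Finset.sum_mul,
    ← Finset.mul_sum, hmid, hraise]
  rw [mul_sub, mul_smul_comm (_ * _), mul_smul_comm, ← mul_assoc (clo q), hmul, hlow]
  simp only [sub_mul, mul_sub, smul_mul_assoc, mul_smul_comm, one_mul, mul_one, mul_assoc]
  match_scalars
  · split_ifs with hab
    · rw [hab]
      linear_combination (v + β) * v * sg_mul_self (p q * p b)
    · simp
  · rw [mul_comm (p a) (p q)]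
    split_ifs with hqa haq haq
    · rw [hqa]; ring
    · exact absurd hqa.symm haq
    · exact absurd haq.symm hqa
    · simp
  · rw [mul_comm (p b) (p q)]
    linear_combination
      ε * ε * sg (p q * p b) * sg (p b) * (v + β) * sg_mul_self (p q * p a) -
      ε * ε * sg (p q * p b) * sg (p b) * v * sg_mul_self (p q * p b)
  · linear_combination v * ε * sg (p b) * εlo q b * sg_mul_self (p q * p b) + v * hsym
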